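/- Weight bound: for every STR derivation Π of Γ ⊢ M : σ and every positive integer r, W(Π,r) ≤ r^{d(Π)} · W(Π,1), where d(Π) is the degree of Π. -/

import Mathlib

/-! ## Untyped λ-calculus with named variables -/

inductive Term : Type
  | var : ℕ → Term
  | lam : ℕ → Term → Term
  | app : Term → Term → Term
deriving DecidableEq

namespace Term

/-- Free variables of a term. -/
def fv : Term → Finset ℕ
  | var x => {x}
  | lam x M => M.fv.erase x
  | app M N => M.fv ∪ N.fv

/-- Simultaneous substitution of terms for free variables. -/
def subst (ρ : ℕ → Option Term) : Term → Term
  | var x => (ρ x).getD (var x)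
  | lam x M => lam x (M.subst (fun y => if y = x then none else ρ y))
  | app M N => app (M.subst ρ) (N.subst ρ)

/-- Substitution `M[N/x]`. -/
def subst1 (M : Term) (x : ℕ) (N : Term) : Term :=
  M.subst (fun y => if y = x then some N else none)

/-- Renaming `M[x/x₁,…,x/xₙ]`. -/
def renameAll (M : Term) (xs : List ℕ) (x : ℕ) : Term :=
  M.subst (fun y => if y ∈ xs then some (var x) else none)

/-- Size of a term. -/
def size : Term → ℕ
  | var _ => 1
  | lam _ M => M.size + 1
  | app M N => M.size + N.size + 1

/-- One step of β-reduction (contextual closure of `(λx.M)N → M[N/x]`). -/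
inductive Beta : Term → Term → Prop
  | beta (x : ℕ) (M N : Term) : Beta (app (lam x M) N) (M.subst1 x N)
  | lam (x : ℕ) {M M' : Term} : Beta M M' → Beta (lam x M) (lam x M')
  | appL {M M' : Term} (N : Term) : Beta M M' → Beta (app M N) (app M' N)
  | appR (M : Term) {N N' : Term} : Beta N N' → Beta (app M N) (app M N')

end Term

/-- β-reduction in exactly `m` steps. -/
inductive BetaN : ℕ → Term → Term → Prop
  | refl (M : Term) : BetaN 0 M M
  | step {M N P : Term} {m : ℕ} : Term.Beta M N → BetaN m N P → BetaN (m + 1) M P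

/-- Strong normalization with respect to β-reduction. -/
def StronglyNormalizing (M : Term) : Prop := Acc (fun a b => Term.Beta b a) M

/-! ## STR types: linear and stratified types.
A stratified type `{σ₁,…,σₙ}` (n > 0) is represented as a head `σ₁` together with
the list `[σ₂,…,σₙ]` of the remaining components. -/

mutual
inductive LinTy : Type
  | tvar : ℕ → LinTy
  | arrow : STy → LinTy → LinTy
  | all : ℕ → LinTy → LinTy

inductive STy : Type
  | lin : LinTy → STy
  | strat : STy → List STy → STy
end

mutual
/-- Free type variables of a linear type. -/
def LinTy.ftv : LinTy → Finset ℕ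
  | .tvar a => {a}
  | .arrow σ A => σ.ftv ∪ A.ftv
  | .all a A => A.ftv.erase a

/-- Free type variables of a stratified type. -/
def STy.ftv : STy → Finset ℕ
  | .lin A => A.ftv
  | .strat σ l => σ.ftv ∪ STy.ftvList l

def STy.ftvList : List STy → Finset ℕ
  | [] => ∅
  | σ :: l => σ.ftv ∪ STy.ftvList l
end

mutual
/-- Substitution of the linear type `A` for the type variable `a`. -/
def LinTy.tsubst (a : ℕ) (A : LinTy) : LinTy → LinTy
  | .tvar b => if b = a then A else .tvar b
  | .arrow σ B => .arrow (STy.tsubst a A σ) (LinTy.tsubst a A B)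
  | .all b B => if b = a then .all b B else .all b (LinTy.tsubst a A B)
termination_by B => sizeOf B

def STy.tsubst (a : ℕ) (A : LinTy) : STy → STy
  | .lin B => .lin (LinTy.tsubst a A B)
  | .strat σ l => .strat (STy.tsubst a A σ) (STy.tsubstList a A l)
termination_by σ => sizeOf σ

def STy.tsubstList (a : ℕ) (A : LinTy) : List STy → List STy
  | [] => []
  | σ :: l => STy.tsubst a A σ :: STy.tsubstList a A l
termination_by l => sizeOf l
end

mutual
/-- The (multi)set of linear components of a type, as a list. -/
def STy.linComps : STy → List LinTy
  | .lin A => [A]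
  | .strat σ l => σ.linComps ++ STy.linCompsList l

def STy.linCompsList : List STy → List LinTy
  | [] => []
  | σ :: l => σ.linComps ++ STy.linCompsList l
end

/-! ## Contexts -/

/-- A context is a partial function from term variables to STR types. -/
abbrev Ctx := ℕ → Option STy

namespace Ctx

def dom (Γ : Ctx) : Set ℕ := {x | Γ x ≠ none}

def empty : Ctx := fun _ => none

/-- `Γ, x:σ`. -/
def cons (Γ : Ctx) (x : ℕ) (σ : STy) : Ctx := fun y => if y = x then some σ else Γ y

/-- `Γ, x₁:σ₁, …, xₙ:σₙ`. -/
def consList (Γ : Ctx) (l : List (ℕ × STy)) : Ctx :=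
  l.foldr (fun p Δ => Ctx.cons Δ p.1 p.2) Γ

/-- Concatenation `Γ, Δ` of two contexts (with disjoint domains). -/
def append (Γ Δ : Ctx) : Ctx := fun x => (Γ x).orElse (fun _ => Δ x)

def appendAll (l : List Ctx) : Ctx := l.foldr append empty

/-- `Γ # Δ` : disjointness of domains. -/
def Disj (Γ Δ : Ctx) : Prop := ∀ x, Γ x = none ∨ Δ x = none

/-- The context `∪ᵢ{Γᵢ}` of rule (st): `(∪ᵢ{Γᵢ})(x) = {Γ₀(x), Γ₁(x), …}`. -/
def stratUnion (Γ0 : Ctx) (Γs : List Ctx) : Ctx := fun x =>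
  (Γ0 x).map (fun σ => STy.strat σ (Γs.filterMap (fun Γ => Γ x)))

end Ctx

/-! ## The STR type assignment system.
`Deriv Γ M σ` is the type of STR derivations of `Γ ⊢ M : σ`. -/

inductive Deriv : Ctx → Term → STy → Type
  | ax (x : ℕ) (A : LinTy) :
      Deriv (Ctx.cons Ctx.empty x (.lin A)) (.var x) (.lin A)
  | w {Γ : Ctx} {M : Term} {σ : STy} (x : ℕ) (A : LinTy) (hx : Γ x = none) :
      Deriv Γ M σ → Deriv (Ctx.cons Γ x (.lin A)) M σ
  | lam {Γ : Ctx} {M : Term} (x : ℕ) (σ : STy) (B : LinTy) (hx : Γ x = none) :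
      Deriv (Ctx.cons Γ x σ) M (.lin B) →
      Deriv Γ (.lam x M) (.lin (.arrow σ B))
  | app {Γ1 Γ2 : Ctx} {M N : Term} {σ : STy} {A : LinTy}
      (hdisj : Ctx.Disj Γ1 Γ2) :
      Deriv Γ1 M (.lin (.arrow σ A)) → Deriv Γ2 N σ →
      Deriv (Ctx.append Γ1 Γ2) (.app M N) (.lin A)
  | m {Γ : Ctx} {M : Term} {τ : STy} (x x0 : ℕ) (xs : List ℕ) (σ0 : STy) (σs : List STy)
      (hlen : xs.length = σs.length)
      (hnodup : (x0 :: xs).Nodup)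
      (hfresh : ∀ y ∈ x0 :: xs, Γ y = none)
      (hx : Γ x = none) :
      Deriv (Ctx.consList Γ ((x0 :: xs).zip (σ0 :: σs))) M τ →
      Deriv (Ctx.cons Γ x (.strat σ0 σs)) (M.renameAll (x0 :: xs) x) τ
  | st {M : Term} (Γ0 : Ctx) (σ0 : STy) (k : ℕ) (Γs : Fin k → Ctx) (σs : Fin k → STy)
      (hdom : ∀ i, Ctx.dom (Γs i) = Ctx.dom Γ0)
      (p0 : Deriv Γ0 M σ0) (ps : ∀ i, Deriv (Γs i) M (σs i)) :
      Deriv (Ctx.stratUnion Γ0 (List.ofFn Γs)) M (.strat σ0 (List.ofFn σs))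
  | allI {Γ : Ctx} {M : Term} {A : LinTy} (a : ℕ)
      (ha : ∀ x σ, Γ x = some σ → a ∉ STy.ftv σ) :
      Deriv Γ M (.lin A) → Deriv Γ M (.lin (.all a A))
  | allE {Γ : Ctx} {M : Term} (a : ℕ) (B A : LinTy) :
      Deriv Γ M (.lin (.all a B)) → Deriv Γ M (.lin (B.tsubst a A))

/-- `M` is typable in STR. -/
def Typable (M : Term) : Prop := ∃ (Γ : Ctx) (σ : STy), Nonempty (Deriv Γ M σ)

/-! ## Measures on derivations -/

/-- The degree of a derivation: maximal nesting of applications of rule (st). -/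
def Deriv.degree : ∀ {Γ : Ctx} {M : Term} {σ : STy}, Deriv Γ M σ → ℕ
  | _, _, _, .ax _ _ => 0
  | _, _, _, .w _ _ _ d => d.degree
  | _, _, _, .lam _ _ _ _ d => d.degree
  | _, _, _, .app _ d1 d2 => max d1.degree d2.degree
  | _, _, _, .m _ _ _ _ _ _ _ _ _ d => d.degree
  | _, _, _, .st _ _ _ _ _ _ p0 ps =>
      (max p0.degree (Finset.univ.sup fun i => (ps i).degree)) + 1
  | _, _, _, .allI _ _ d => d.degree
  | _, _, _, .allE _ _ _ d => d.degree

/-- The weight `W(Π, r)` of a derivation with respect to `r`. -/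
def Deriv.weight (r : ℕ) : ∀ {Γ : Ctx} {M : Term} {σ : STy}, Deriv Γ M σ → ℕ
  | _, _, _, .ax _ _ => 1
  | _, _, _, .w _ _ _ d => d.weight r
  | _, _, _, .lam _ _ _ _ d => d.weight r + 1
  | _, _, _, .app _ d1 d2 => d1.weight r + d2.weight r + 1
  | _, _, _, .m _ _ _ _ _ _ _ _ _ d => d.weight r
  | _, _, _, .st _ _ _ _ _ _ p0 ps =>
      r * max (p0.weight r) (Finset.univ.sup fun i => (ps i).weight r)
  | _, _, _, .allI _ _ d => d.weight r
  | _, _, _, .allE _ _ _ d => d.weight r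

/-- The rank `rk(Π)` of a derivation: the maximum of 1 and, for every application of
rule (m) contracting `x₀,…,xₙ` with premise subject `M`, the cardinality of
`{x₀,…,xₙ} ∩ FV(M)`. -/
def Deriv.rank : ∀ {Γ : Ctx} {M : Term} {σ : STy}, Deriv Γ M σ → ℕ
  | _, _, _, .ax _ _ => 1
  | _, _, _, .w _ _ _ d => d.rank
  | _, _, _, .lam _ _ _ _ d => d.rank
  | _, _, _, .app _ d1 d2 => max d1.rank d2.rank
  | _, _, _, @Deriv.m _ M _ _ x0 xs _ _ _ _ _ _ d =>
      max ((x0 :: xs).toFinset ∩ M.fv).card d.rank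
  | _, _, _, .st _ _ _ _ _ _ p0 ps =>
      max p0.rank (Finset.univ.sup fun i => (ps i).rank)
  | _, _, _, .allI _ _ d => d.rank
  | _, _, _, .allE _ _ _ d => d.rank

/-! ## Renaming sequences -/

/-- `RenSeq Π₀ Π` : the derivation `Π` is obtained from `Π₀` by a (possibly empty)
sequence of applications of the renaming rules (w) and (m). -/
inductive RenSeq :
    ∀ {Γ : Ctx} {M : Term} {σ : STy}, Deriv Γ M σ →
    ∀ {Γ' : Ctx} {M' : Term} {σ' : STy}, Deriv Γ' M' σ' → Prop
  | refl {Γ M σ} (d : Deriv Γ M σ) : RenSeq d d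
  | w {Γ0 M0 σ0 Γ M σ} {d0 : Deriv Γ0 M0 σ0} {d : Deriv Γ M σ}
      (x : ℕ) (A : LinTy) (hx : Γ x = none) :
      RenSeq d0 d → RenSeq d0 (Deriv.w x A hx d)
  | m {Γ0 M0 τ0} {Γ : Ctx} {M : Term} {τ : STy}
      (x x0 : ℕ) (xs : List ℕ) (σ0 : STy) (σs : List STy)
      (hlen : xs.length = σs.length) (hnodup : (x0 :: xs).Nodup)
      (hfresh : ∀ y ∈ x0 :: xs, Γ y = none) (hx : Γ x = none)
      {d0 : Deriv Γ0 M0 τ0} {d : Deriv (Ctx.consList Γ ((x0 :: xs).zip (σ0 :: σs))) M τ} :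
      RenSeq d0 d → RenSeq d0 (Deriv.m x x0 xs σ0 σs hlen hnodup hfresh hx d)

/-- **Weight bound**: `W(D,r) ≤ r^(d(D)) * W(D,1)` for every positive integer `r`. -/
theorem weight_bound {Γ : Ctx} {M : Term} {σ : STy} (D : Deriv Γ M σ)
    (r : ℕ) (hr : 1 ≤ r) :
    D.weight r ≤ r ^ D.degree * D.weight 1 := by
  induction D with
  | ax x A => simp [Deriv.weight, Deriv.degree]
  | w x A hx d ih => simpa only [Deriv.weight, Deriv.degree] using ih
  | m x x0 xs σ0 σs hlen hnodup hfresh hx d ih =>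
    simpa only [Deriv.weight, Deriv.degree] using ih
  | allI a ha d ih => simpa only [Deriv.weight, Deriv.degree] using ih
  | allE a B A d ih => simpa only [Deriv.weight, Deriv.degree] using ih
  | lam x σ B hx d ih =>
    simp only [Deriv.weight, Deriv.degree]
    rw [mul_add, mul_one]
    exact add_le_add ih (Nat.one_le_pow _ _ hr)
  | app hdisj d1 d2 ih1 ih2 =>
    simp only [Deriv.weight, Deriv.degree]
    rw [mul_add, mul_add, mul_one]
    refine add_le_add (add_le_add (ih1.trans ?_) (ih2.trans ?_)) (Nat.one_le_pow _ _ hr)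
    · exact Nat.mul_le_mul_right _ (Nat.pow_le_pow_right hr (le_max_left _ _))
    · exact Nat.mul_le_mul_right _ (Nat.pow_le_pow_right hr (le_max_right _ _))
  | st Γ0 σ0 k Γs σs hdom p0 ps ih0 ihs =>
    simp only [Deriv.weight, Deriv.degree]
    rw [one_mul, pow_succ', mul_assoc]
    refine Nat.mul_le_mul_left r (max_le (ih0.trans ?_) (Finset.sup_le fun i _ => (ihs i).trans ?_))
    · exact Nat.mul_le_mul (Nat.pow_le_pow_right hr (le_max_left _ _)) (le_max_left _ _)
    · have hdeg := Finset.le_sup (f := fun i => (ps i).degree) (Finset.mem_univ i)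
      have hweight := Finset.le_sup (f := fun i => (ps i).weight 1) (Finset.mem_univ i)
      exact Nat.mul_le_mul (Nat.pow_le_pow_right hr (le_max_of_le_right hdeg))
        (le_max_of_le_right hweight)
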